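/- arXiv:2105.08666 — 7 statements merged into one kernel-verified Lean document; each statement's English description precedes it below -/
import Mathlib

section
/- In the finite MDP setting, the regularized Bellman optimality operator T*_Ω is a γ-contraction with respect to the supremum norm: for any Q₁, Q₂ : S × A → ℝ, max_{(s,a)} |(T*_Ω Q₁)(s,a) − (T*_Ω Q₂)(s,a)| ≤ γ · max_{(s,a)} |Q₁(s,a) − Q₂(s,a)|. -/
/-- Kullback–Leibler divergence on a finite set, with the convention 0·log 0 = 0. -/
noncomputable def KL {A : Type*} [Fintype A] (q p : A → ℝ) : ℝ :=
  ∑ a, q a * Real.log (q a / p a)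

/-- Regularized Bellman optimality operator `T*_Ω`:
`(T*_Ω Q)(s,a) = r(s,a) + γ·∑_{s'} P(s'|s,a)·λ·log(∑_{a'} p̃(a')·exp(Q(s',a')/λ))`. -/
noncomputable def Topt {S A : Type*} [Fintype S] [Fintype A]
    (P : S → A → S → ℝ) (r : S → A → ℝ) (γ lam : ℝ) (p : A → ℝ)
    (Q : S → A → ℝ) : S → A → ℝ :=
  fun s a => r s a +
    γ * ∑ s', P s a s' * (lam * Real.log (∑ a', p a' * Real.exp (Q s' a' / lam)))

/-- Regularized Bellman operator `T^π_Ω` for a stationary policy `π`: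
`(T^π_Ω Q)(s,a) = r(s,a) + γ·∑_{s'} P(s'|s,a)·(∑_{a'} π(a'|s')·Q(s',a') − λ·KL(π(·|s'), p̃))`. -/
noncomputable def Tpi {S A : Type*} [Fintype S] [Fintype A]
    (P : S → A → S → ℝ) (r : S → A → ℝ) (γ lam : ℝ) (p : A → ℝ)
    (pol : S → A → ℝ) (Q : S → A → ℝ) : S → A → ℝ :=
  fun s a => r s a +
    γ * ∑ s', P s a s' * ((∑ a', pol s' a' * Q s' a') - lam * KL (pol s') p)

/-- One-sided nonexpansiveness of the weighted log-sum-exp. -/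
theorem logSumExp_le_add {A : Type*} [Fintype A] [Nonempty A] {lam : ℝ} (hlam : 0 < lam)
    {p : A → ℝ} (hp : ∀ a, 0 < p a) {f g : A → ℝ} {M : ℝ} (h : ∀ a, f a ≤ g a + M) :
    lam * Real.log (∑ a, p a * Real.exp (f a / lam))
      ≤ lam * Real.log (∑ a, p a * Real.exp (g a / lam)) + M := by
  have hpos : ∀ q : A → ℝ, 0 < ∑ a, p a * Real.exp (q a / lam) := fun q =>
    Finset.sum_pos (fun a _ => mul_pos (hp a) (Real.exp_pos _)) Finset.univ_nonempty
  have hle : ∑ a, p a * Real.exp (f a / lam)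
      ≤ (∑ a, p a * Real.exp (g a / lam)) * Real.exp (M / lam) := by
    rw [Finset.sum_mul]
    refine Finset.sum_le_sum fun a _ => ?_
    rw [mul_assoc, ← Real.exp_add, ← add_div]
    exact mul_le_mul_of_nonneg_left
      (Real.exp_le_exp.2 (div_le_div_of_nonneg_right (h a) hlam.le)) (hp a).le
  have hlog := Real.log_le_log (hpos f) hle
  rw [Real.log_mul (hpos g).ne' (Real.exp_pos _).ne', Real.log_exp] at hlog
  calc lam * Real.log (∑ a, p a * Real.exp (f a / lam))
      ≤ lam * (Real.log (∑ a, p a * Real.exp (g a / lam)) + M / lam) :=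
        mul_le_mul_of_nonneg_left hlog hlam.le
    _ = lam * Real.log (∑ a, p a * Real.exp (g a / lam)) + M := by
        rw [mul_add, mul_div_cancel₀ M hlam.ne']

/-- The weighted log-sum-exp is nonexpansive in the sup norm. -/
theorem abs_logSumExp_sub_le {A : Type*} [Fintype A] [Nonempty A] {lam : ℝ} (hlam : 0 < lam)
    {p : A → ℝ} (hp : ∀ a, 0 < p a) {f g : A → ℝ} {M : ℝ} (h : ∀ a, |f a - g a| ≤ M) :
    |lam * Real.log (∑ a, p a * Real.exp (f a / lam))
      - lam * Real.log (∑ a, p a * Real.exp (g a / lam))| ≤ M := by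
  have hfg := logSumExp_le_add hlam hp (f := f) (g := g) (M := M)
    fun a => by linarith [(abs_le.1 (h a)).2]
  have hgf := logSumExp_le_add hlam hp (f := g) (g := f) (M := M)
    fun a => by linarith [(abs_le.1 (h a)).1]
  exact abs_le.2 ⟨by linarith, by linarith⟩

/-- The regularized Bellman optimality operator is a γ-contraction in the sup norm. -/
theorem stmt_6 {S A : Type*} [Fintype S] [Fintype A] [Nonempty S] [Nonempty A]
    (P : S → A → S → ℝ) (hP0 : ∀ s a s', 0 ≤ P s a s')
    (hP1 : ∀ s a, ∑ s', P s a s' = 1)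
    (r : S → A → ℝ)
    (γ : ℝ) (hγ0 : 0 ≤ γ) (hγ1 : γ < 1)
    (lam : ℝ) (hlam : 0 < lam)
    (p : A → ℝ) (hp : ∀ a, 0 < p a) (hpsum : ∑ a, p a = 1)
    (Q₁ Q₂ : S → A → ℝ) :
    Finset.univ.sup' Finset.univ_nonempty
        (fun sa : S × A =>
          |Topt P r γ lam p Q₁ sa.1 sa.2 - Topt P r γ lam p Q₂ sa.1 sa.2|)
      ≤ γ * Finset.univ.sup' Finset.univ_nonempty
          (fun sa : S × A => |Q₁ sa.1 sa.2 - Q₂ sa.1 sa.2|) := by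
  set M := Finset.univ.sup' Finset.univ_nonempty
    (fun sa : S × A => |Q₁ sa.1 sa.2 - Q₂ sa.1 sa.2|)
  have hQ : ∀ s a, |Q₁ s a - Q₂ s a| ≤ M := fun s a =>
    Finset.le_sup' (fun sa : S × A => |Q₁ sa.1 sa.2 - Q₂ sa.1 sa.2|) (Finset.mem_univ (s, a))
  refine Finset.sup'_le _ _ fun sa _ => ?_
  simp only [Topt]
  rw [add_sub_add_left_eq_sub, ← mul_sub, ← Finset.sum_sub_distrib, abs_mul, abs_of_nonneg hγ0]
  refine mul_le_mul_of_nonneg_left ?_ hγ0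
  calc _ ≤ ∑ s', P sa.1 sa.2 s' * M := by
        refine (Finset.abs_sum_le_sum_abs _ _).trans (Finset.sum_le_sum fun s' _ => ?_)
        rw [← mul_sub, abs_mul, abs_of_nonneg (hP0 _ _ _)]
        exact mul_le_mul_of_nonneg_left (abs_logSumExp_sub_le hlam hp (hQ s')) (hP0 _ _ _)
    _ = M := by rw [← Finset.sum_mul, hP1, one_mul]
end

section
/- In the finite MDP setting, the regularized Bellman optimality operator T*_Ω has a unique fixed point: there exists exactly one function Q*_Ω : S × A → ℝ such that T*_Ω Q*_Ω = Q*_Ω. -/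
/-- The weighted log-sum-exp at temperature `lam` grows by at most `d` when its argument does. -/
lemma mul_log_sum_exp_le_add {A : Type*} [Fintype A] [Nonempty A] {lam : ℝ} (hlam : 0 < lam)
    {p : A → ℝ} (hp : ∀ a, 0 < p a) {x y : A → ℝ} {d : ℝ} (h : ∀ a, x a ≤ y a + d) :
    lam * Real.log (∑ a, p a * Real.exp (x a / lam)) ≤
      lam * Real.log (∑ a, p a * Real.exp (y a / lam)) + d := by
  have hpos : ∀ z : A → ℝ, 0 < ∑ a, p a * Real.exp (z a / lam) := fun z =>
    Finset.sum_pos (fun a _ => mul_pos (hp a) (Real.exp_pos _)) Finset.univ_nonempty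
  have hle : ∑ a, p a * Real.exp (x a / lam) ≤
      (∑ a, p a * Real.exp (y a / lam)) * Real.exp (d / lam) := by
    rw [Finset.sum_mul]
    refine Finset.sum_le_sum fun a _ => ?_
    rw [mul_assoc, ← Real.exp_add, ← add_div]
    have := h a
    have := (hp a).le
    gcongr
  calc lam * Real.log (∑ a, p a * Real.exp (x a / lam))
      ≤ lam * Real.log ((∑ a, p a * Real.exp (y a / lam)) * Real.exp (d / lam)) :=
        mul_le_mul_of_nonneg_left (Real.log_le_log (hpos x) hle) hlam.le
    _ = lam * Real.log (∑ a, p a * Real.exp (y a / lam)) + d := by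
        rw [Real.log_mul (hpos y).ne' (Real.exp_pos _).ne', Real.log_exp]
        field_simp

/-- `Topt` grows by at most `γ * d` when its argument grows by at most `d`. -/
lemma Topt_le_add {S A : Type*} [Fintype S] [Fintype A] [Nonempty A]
    {P : S → A → S → ℝ} (hP0 : ∀ s a s', 0 ≤ P s a s') (hP1 : ∀ s a, ∑ s', P s a s' = 1)
    (r : S → A → ℝ) {γ : ℝ} (hγ0 : 0 ≤ γ) {lam : ℝ} (hlam : 0 < lam)
    {p : A → ℝ} (hp : ∀ a, 0 < p a) {Q R : S → A → ℝ} {d : ℝ}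
    (h : ∀ s a, Q s a ≤ R s a + d) (s : S) (a : A) :
    Topt P r γ lam p Q s a ≤ Topt P r γ lam p R s a + γ * d := by
  have hsum := Finset.sum_le_sum fun s' (_ : s' ∈ Finset.univ) =>
    mul_le_mul_of_nonneg_left (mul_log_sum_exp_le_add hlam hp (h s')) (hP0 s a s')
  simp only [mul_add, Finset.sum_add_distrib] at hsum
  rw [← Finset.sum_mul, hP1, one_mul] at hsum
  have := mul_le_mul_of_nonneg_left hsum hγ0
  unfold Topt
  linarith

/-- `Topt` is a `γ`-contraction for the sup norm. -/
lemma contractingWith_Topt {S A : Type*} [Fintype S] [Fintype A] [Nonempty A]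
    {P : S → A → S → ℝ} (hP0 : ∀ s a s', 0 ≤ P s a s') (hP1 : ∀ s a, ∑ s', P s a s' = 1)
    (r : S → A → ℝ) {γ : ℝ} (hγ0 : 0 ≤ γ) (hγ1 : γ < 1) {lam : ℝ} (hlam : 0 < lam)
    {p : A → ℝ} (hp : ∀ a, 0 < p a) :
    ContractingWith ⟨γ, hγ0⟩ (Topt P r γ lam p) := by
  refine ⟨hγ1, LipschitzWith.of_dist_le_mul fun Q R => ?_⟩
  have key : ∀ (Q R : S → A → ℝ) s a, Q s a ≤ R s a + dist Q R := fun Q R s a => by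
    have h := (dist_le_pi_dist (Q s) (R s) a).trans (dist_le_pi_dist Q R s)
    rw [Real.dist_eq] at h
    linarith [le_abs_self (Q s a - R s a)]
  change _ ≤ γ * dist Q R
  have hd : 0 ≤ γ * dist Q R := mul_nonneg hγ0 dist_nonneg
  refine (dist_pi_le_iff hd).2 fun s => (dist_pi_le_iff hd).2 fun a => ?_
  have h₁ := Topt_le_add hP0 hP1 r hγ0 hlam hp (key Q R) s a
  have h₂ := Topt_le_add hP0 hP1 r hγ0 hlam hp (key R Q) s a
  rw [dist_comm R Q] at h₂
  rw [Real.dist_eq, abs_le]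
  constructor <;> linarith

/-- The regularized Bellman optimality operator has a unique fixed point. -/
theorem stmt_7 {S A : Type*} [Fintype S] [Fintype A] [Nonempty S] [Nonempty A]
    (P : S → A → S → ℝ) (hP0 : ∀ s a s', 0 ≤ P s a s')
    (hP1 : ∀ s a, ∑ s', P s a s' = 1)
    (r : S → A → ℝ)
    (γ : ℝ) (hγ0 : 0 ≤ γ) (hγ1 : γ < 1)
    (lam : ℝ) (hlam : 0 < lam)
    (p : A → ℝ) (hp : ∀ a, 0 < p a) (hpsum : ∑ a, p a = 1) :
    ∃! Q : S → A → ℝ, Topt P r γ lam p Q = Q := by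
  have hT := contractingWith_Topt hP0 hP1 r hγ0 hγ1 hlam hp
  exact ⟨_, hT.fixedPoint_isFixedPt, fun Q hQ => hT.fixedPoint_unique hQ⟩
end

section
/- In the finite MDP setting, let Q : S × A → ℝ be arbitrary and let π_Q be the softmax policy of Q, defined by π_Q(a|s) = p̃(a)·exp(Q(s,a)/λ) / (∑_{a'} p̃(a')·exp(Q(s,a')/λ)). Then for all (s,a), (T^{π_Q}_Ω Q)(s,a) = (T*_Ω Q)(s,a); that is, the softmax policy achieves the regularized Bellman optimality backup. -/
/-- The Gibbs variational value: a softmax distribution attains the log-partition function. -/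
theorem softmax_sum_sub_KL {A : Type*} [Fintype A] [Nonempty A] {lam : ℝ} (hlam : lam ≠ 0)
    {p : A → ℝ} (hp : ∀ a, 0 < p a) (f q : A → ℝ)
    (hq : ∀ a, q a = p a * Real.exp (f a / lam) / ∑ a', p a' * Real.exp (f a' / lam)) :
    (∑ a, q a * f a) - lam * KL q p
      = lam * Real.log (∑ a, p a * Real.exp (f a / lam)) := by
  set Z := ∑ a, p a * Real.exp (f a / lam) with hZ
  have hZpos : 0 < Z :=
    Finset.sum_pos (fun a _ => mul_pos (hp a) (Real.exp_pos _)) Finset.univ_nonempty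
  have hsum : ∑ a, q a = 1 := by
    simp_rw [hq]
    rw [← Finset.sum_div, ← hZ, div_self hZpos.ne']
  have hlog : ∀ a, Real.log (q a / p a) = f a / lam - Real.log Z := fun a => by
    have hratio : q a / p a = Real.exp (f a / lam) / Z := by
      rw [hq]
      field_simp [(hp a).ne']
    rw [hratio, Real.log_div (Real.exp_pos _).ne' hZpos.ne', Real.log_exp]
  calc (∑ a, q a * f a) - lam * KL q p
      = ∑ a, q a * (lam * Real.log Z) := by
        rw [KL, Finset.mul_sum, ← Finset.sum_sub_distrib]
        refine Finset.sum_congr rfl fun a _ => ?_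
        rw [hlog]
        field_simp
        ring
    _ = lam * Real.log Z := by rw [← Finset.sum_mul, hsum, one_mul]

/-- The softmax policy of `Q` achieves the regularized Bellman optimality backup:
`T^{π_Q}_Ω Q = T*_Ω Q`. -/
theorem stmt_9 {S A : Type*} [Fintype S] [Fintype A] [Nonempty S] [Nonempty A]
    (P : S → A → S → ℝ) (hP0 : ∀ s a s', 0 ≤ P s a s')
    (hP1 : ∀ s a, ∑ s', P s a s' = 1)
    (r : S → A → ℝ)
    (γ : ℝ) (hγ0 : 0 ≤ γ) (hγ1 : γ < 1)
    (lam : ℝ) (hlam : 0 < lam)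
    (p : A → ℝ) (hp : ∀ a, 0 < p a) (hpsum : ∑ a, p a = 1)
    (Q : S → A → ℝ)
    (polQ : S → A → ℝ)
    (hpolQ : ∀ s a, polQ s a
      = p a * Real.exp (Q s a / lam) / (∑ a', p a' * Real.exp (Q s a' / lam))) :
    ∀ s a, Tpi P r γ lam p polQ Q s a = Topt P r γ lam p Q s a := by
  intro s a
  simp only [Tpi, Topt, softmax_sum_sub_KL hlam.ne' hp (Q _) (polQ _) (hpolQ _)]
end

section
/- In the finite MDP setting, let Q*_Ω be the fixed point of the regularized Bellman optimality operator T*_Ω, and for a stationary policy π let Q^π_Ω be the fixed point of the regularized Bellman operator T^π_Ω. Then for every stationary policy π and every (s,a), Q^π_Ω(s,a) ≤ Q*_Ω(s,a); that is, Q*_Ω is the regularized optimal state-action value function. -/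
/-- Gibbs variational inequality on a finite set. -/
theorem sum_mul_sub_KL_le_log_sum_exp {A : Type*} [Fintype A] [Nonempty A]
    {lam : ℝ} (hlam : 0 < lam) {p : A → ℝ} (hp : ∀ a, 0 < p a)
    {q : A → ℝ} (hq0 : ∀ a, 0 ≤ q a) (hq1 : ∑ a, q a = 1) (f : A → ℝ) :
    (∑ a, q a * f a) - lam * KL q p ≤
      lam * Real.log (∑ a, p a * Real.exp (f a / lam)) := by
  set Z := ∑ a, p a * Real.exp (f a / lam) with hZ
  have hZpos : 0 < Z :=
    Finset.sum_pos (fun a _ => mul_pos (hp a) (Real.exp_pos _)) Finset.univ_nonempty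
  have hterm : ∀ a, q a * (f a / lam) - q a * Real.log (q a / p a) - q a * Real.log Z ≤
      p a * Real.exp (f a / lam) / Z - q a := by
    intro a
    rcases (hq0 a).eq_or_lt with h | h
    · simpa [← h] using div_nonneg (mul_pos (hp a) (Real.exp_pos _)).le hZpos.le
    · have hpos : 0 < p a * Real.exp (f a / lam) / Z / q a := by
        have := hp a
        positivity
      have hlog := Real.log_le_sub_one_of_pos hpos
      rw [Real.log_div (by have := hp a; positivity) h.ne',
        Real.log_div (by have := hp a; positivity) hZpos.ne',
        Real.log_mul (hp a).ne' (Real.exp_pos _).ne', Real.log_exp] at hlog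
      have hmul := mul_le_mul_of_nonneg_left hlog h.le
      rw [mul_sub (q a) (_ / q a), mul_div_cancel₀ _ h.ne'] at hmul
      rw [Real.log_div h.ne' (hp a).ne']
      linarith
  have hsum := Finset.sum_le_sum fun a (_ : a ∈ Finset.univ) => hterm a
  simp only [Finset.sum_sub_distrib, ← Finset.sum_mul, ← Finset.sum_div, hq1, ← hZ,
    div_self hZpos.ne', one_mul, ← mul_div_assoc] at hsum
  have hmul := mul_le_mul_of_nonneg_left hsum hlam.le
  rw [mul_sub, mul_sub, mul_div_cancel₀ _ hlam.ne'] at hmul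
  unfold KL
  linarith

/-- `Q*_Ω` (the fixed point of `T*_Ω`) dominates `Q^π_Ω` (the fixed point of
`T^π_Ω`) for every stationary policy `π`. -/
theorem stmt_11 {S A : Type*} [Fintype S] [Fintype A] [Nonempty S] [Nonempty A]
    (P : S → A → S → ℝ) (hP0 : ∀ s a s', 0 ≤ P s a s')
    (hP1 : ∀ s a, ∑ s', P s a s' = 1)
    (r : S → A → ℝ)
    (γ : ℝ) (hγ0 : 0 ≤ γ) (hγ1 : γ < 1)
    (lam : ℝ) (hlam : 0 < lam)
    (p : A → ℝ) (hp : ∀ a, 0 < p a) (hpsum : ∑ a, p a = 1)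
    (QoptΩ : S → A → ℝ) (hQopt : Topt P r γ lam p QoptΩ = QoptΩ)
    (pol : S → A → ℝ) (hpol0 : ∀ s a, 0 ≤ pol s a)
    (hpol1 : ∀ s, ∑ a, pol s a = 1)
    (QpiΩ : S → A → ℝ) (hQpi : Tpi P r γ lam p pol QpiΩ = QpiΩ) :
    ∀ s a, QpiΩ s a ≤ QoptΩ s a := by
  obtain ⟨⟨s₀, a₀⟩, hmax⟩ := Finite.exists_max fun x : S × A => QpiΩ x.1 x.2 - QoptΩ x.1 x.2
  set M := QpiΩ s₀ a₀ - QoptΩ s₀ a₀ with hM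
  have hstate : ∀ s, (∑ a, pol s a * QpiΩ s a) - lam * KL (pol s) p ≤
      lam * Real.log (∑ a, p a * Real.exp (QoptΩ s a / lam)) + M := by
    intro s
    have hgibbs := sum_mul_sub_KL_le_log_sum_exp hlam hp (hpol0 s) (hpol1 s) (QoptΩ s)
    have hdiff : ∑ a, pol s a * QpiΩ s a ≤ ∑ a, (pol s a * QoptΩ s a + pol s a * M) :=
      Finset.sum_le_sum fun a _ => by
        rw [← mul_add]
        exact mul_le_mul_of_nonneg_left (by linarith [hmax (s, a)]) (hpol0 s a)
    rw [Finset.sum_add_distrib, ← Finset.sum_mul, hpol1, one_mul] at hdiff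
    linarith
  have hcontr : M ≤ γ * M := by
    have hpi := congrFun (congrFun hQpi s₀) a₀
    have hopt := congrFun (congrFun hQopt s₀) a₀
    have hnext := mul_le_mul_of_nonneg_left (Finset.sum_le_sum fun s' (_ : s' ∈ Finset.univ) =>
      mul_le_mul_of_nonneg_left (hstate s') (hP0 s₀ a₀ s')) hγ0
    simp only [mul_add (P _ _ _), Finset.sum_add_distrib, ← Finset.sum_mul, hP1, one_mul] at hnext
    unfold Tpi at hpi
    unfold Topt at hopt
    linarith
  intro s a
  nlinarith [hmax (s, a)]
end

section
/- In the finite MDP setting, let Q*_Ω be the fixed point of the regularized Bellman optimality operator T*_Ω, and let π*_Ω be the softmax policy of Q*_Ω, defined by π*_Ω(a|s) = p̃(a)·exp(Q*_Ω(s,a)/λ) / (∑_{a'} p̃(a')·exp(Q*_Ω(s,a')/λ)). Then Q*_Ω is the fixed point of the regularized Bellman operator T^{π*_Ω}_Ω, i.e. T^{π*_Ω}_Ω Q*_Ω = Q*_Ω; in other words, the softmax policy π*_Ω attains the regularized optimal value, Q^{π*_Ω}_Ω = Q*_Ω. -/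
/-- The Gibbs distribution attains the log-partition value: the expectation of `f` under
the softmax of `f` relative to `p`, penalized by the divergence from `p`, is `log-sum-exp`. -/
theorem softmax_expectation_sub_KL {A : Type*} [Fintype A] [Nonempty A] {lam : ℝ}
    (hlam : lam ≠ 0) {p : A → ℝ} (hp : ∀ a, 0 < p a) (f q : A → ℝ)
    (hq : ∀ a, q a = p a * Real.exp (f a / lam) / ∑ b, p b * Real.exp (f b / lam)) :
    (∑ a, q a * f a) - lam * KL q p = lam * Real.log (∑ a, p a * Real.exp (f a / lam)) := by
  set Z := ∑ a, p a * Real.exp (f a / lam) with hZ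
  have hZpos : 0 < Z :=
    Finset.sum_pos (fun a _ => mul_pos (hp a) (Real.exp_pos _)) Finset.univ_nonempty
  have hsum : ∑ a, q a = 1 := by
    simp_rw [hq]
    rw [← Finset.sum_div, ← hZ, div_self hZpos.ne']
  have hlog : ∀ a, Real.log (q a / p a) = f a / lam - Real.log Z := by
    intro a
    have hratio : q a / p a = Real.exp (f a / lam) / Z := by
      rw [hq]
      field_simp [(hp a).ne']
    rw [hratio, Real.log_div (Real.exp_ne_zero _) hZpos.ne', Real.log_exp]
  calc (∑ a, q a * f a) - lam * KL q p
      = ∑ a, q a * (lam * Real.log Z) := by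
        rw [KL, Finset.mul_sum, ← Finset.sum_sub_distrib]
        refine Finset.sum_congr rfl fun a _ => ?_
        rw [hlog]
        field_simp
        ring
    _ = lam * Real.log Z := by rw [← Finset.sum_mul, hsum, one_mul]

/-- The softmax policy of `Q*_Ω` attains the regularized optimal value:
`T^{π*_Ω}_Ω Q*_Ω = Q*_Ω`. -/
theorem stmt_12 {S A : Type*} [Fintype S] [Fintype A] [Nonempty S] [Nonempty A]
    (P : S → A → S → ℝ) (hP0 : ∀ s a s', 0 ≤ P s a s')
    (hP1 : ∀ s a, ∑ s', P s a s' = 1)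
    (r : S → A → ℝ)
    (γ : ℝ) (hγ0 : 0 ≤ γ) (hγ1 : γ < 1)
    (lam : ℝ) (hlam : 0 < lam)
    (p : A → ℝ) (hp : ∀ a, 0 < p a) (hpsum : ∑ a, p a = 1)
    (QoptΩ : S → A → ℝ) (hQopt : Topt P r γ lam p QoptΩ = QoptΩ)
    (polstar : S → A → ℝ)
    (hpolstar : ∀ s a, polstar s a
      = p a * Real.exp (QoptΩ s a / lam) / (∑ a', p a' * Real.exp (QoptΩ s a' / lam))) :
    Tpi P r γ lam p polstar QoptΩ = QoptΩ := by
  refine Eq.trans ?_ hQopt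
  funext s a
  simp only [Tpi, Topt,
    softmax_expectation_sub_KL hlam.ne' hp (QoptΩ _) (polstar _) (hpolstar _)]
end

section
/- In the finite MDP setting, fix a stationary policy π. Let Q^π be the fixed point of the (unregularized) Bellman operator T^π, where (T^π Q)(s,a) = r(s,a) + γ·∑_{s'} P(s'|s,a)·∑_{a'} π(a'|s')·Q(s',a'), and let Q^π_Ω be the fixed point of the regularized Bellman operator T^π_Ω. Define V^π(s) = ∑_a π(a|s)·Q^π(s,a) and V^π_Ω(s) = ∑_a π(a|s)·Q^π_Ω(s,a) − λ·KL(π(·|s), p̃), and set C = λ·max_{a∈A} log(1/p̃(a)). Then for every state s, V^π(s) − C/(1−γ) ≤ V^π_Ω(s) ≤ V^π(s). -/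
/-- Unregularized Bellman operator `T^π` for a stationary policy:
`(T^π Q)(s,a) = r(s,a) + γ·∑_{s'} P(s'|s,a)·∑_{a'} π(a'|s')·Q(s',a')`. -/
noncomputable def Tpi0 {S A : Type*} [Fintype S] [Fintype A]
    (P : S → A → S → ℝ) (r : S → A → ℝ) (γ : ℝ)
    (pol : S → A → ℝ) (Q : S → A → ℝ) : S → A → ℝ :=
  fun s a => r s a + γ * ∑ s', P s a s' * (∑ a', pol s' a' * Q s' a')

theorem KL_nonneg {A : Type*} [Fintype A] {q p : A → ℝ} (hq : ∀ a, 0 ≤ q a)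
    (hp : ∀ a, 0 < p a) (hsum : ∑ a, p a ≤ ∑ a, q a) : 0 ≤ KL q p := by
  have h : ∑ a, (q a - p a) ≤ KL q p := by
    refine Finset.sum_le_sum fun a _ => ?_
    rcases (hq a).eq_or_lt with h0 | h0
    · simp [← h0, (hp a).le]
    · have h1 := mul_le_mul_of_nonneg_left
        (Real.one_sub_inv_le_log_of_pos (div_pos h0 (hp a))) h0.le
      have h2 : q a * (1 - (q a / p a)⁻¹) = q a - p a := by
        field_simp
      linarith
  rw [Finset.sum_sub_distrib] at h
  linarith

theorem KL_le_of_log_one_div_le {A : Type*} [Fintype A] {q p : A → ℝ} {M : ℝ}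
    (hq : ∀ a, 0 ≤ q a) (hq1 : ∑ a, q a = 1) (hp : ∀ a, 0 < p a)
    (hM : ∀ a, Real.log (1 / p a) ≤ M) : KL q p ≤ M := by
  calc KL q p ≤ ∑ a, q a * M := by
        refine Finset.sum_le_sum fun a _ => ?_
        rcases (hq a).eq_or_lt with h0 | h0
        · simp [← h0]
        · refine mul_le_mul_of_nonneg_left (le_trans ?_ (hM a)) h0.le
          have hle : q a ≤ 1 :=
            hq1 ▸ Finset.single_le_sum (fun b _ => hq b) (Finset.mem_univ a)
          exact Real.log_le_log (div_pos h0 (hp a))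
            (div_le_div_of_nonneg_right hle (hp a).le)
    _ = M := by rw [← Finset.sum_mul, hq1, one_mul]

/-- Averages of `D` under weights summing to one are bounded by any upper bound of `D`. -/
theorem sum_mul_le_of_forall_le {ι : Type*} [Fintype ι] {w D : ι → ℝ} {M : ℝ}
    (hw : ∀ i, 0 ≤ w i) (hw1 : ∑ i, w i = 1) (hD : ∀ i, D i ≤ M) : ∑ i, w i * D i ≤ M :=
  calc ∑ i, w i * D i ≤ ∑ i, w i * M :=
        Finset.sum_le_sum fun i _ => mul_le_mul_of_nonneg_left (hD i) (hw i)
    _ = M := by rw [← Finset.sum_mul, hw1, one_mul]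

/-- A solution of the policy evaluation equation with cost at most `c` is at most `c / (1 - γ)`. -/
theorem policy_eval_le {S A : Type*} [Fintype S] [Fintype A]
    {P : S → A → S → ℝ} (hP0 : ∀ s a s', 0 ≤ P s a s') (hP1 : ∀ s a, ∑ s', P s a s' = 1)
    {pol : S → A → ℝ} (hpol0 : ∀ s a, 0 ≤ pol s a) (hpol1 : ∀ s, ∑ a, pol s a = 1)
    {γ : ℝ} (hγ0 : 0 ≤ γ) (hγ1 : γ < 1) {k D : S → ℝ} {c : ℝ} (hk : ∀ s, k s ≤ c)
    (hD : ∀ s, D s = k s + γ * ∑ a, pol s a * ∑ s', P s a s' * D s') (s : S) :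
    D s ≤ c / (1 - γ) := by
  have : Nonempty S := ⟨s⟩
  obtain ⟨m, hm⟩ := Finite.exists_max D
  refine (hm s).trans ?_
  have h : ∑ a, pol m a * ∑ s', P m a s' * D s' ≤ D m :=
    sum_mul_le_of_forall_le (hpol0 m) (hpol1 m) fun a =>
      sum_mul_le_of_forall_le (hP0 m a) (hP1 m a) hm
  rw [le_div_iff₀ (by linarith)]
  linarith [hD m, hk m, mul_le_mul_of_nonneg_left h hγ0]

/-- Value discrepancy for a fixed policy:
`V^π(s) − C/(1−γ) ≤ V^π_Ω(s) ≤ V^π(s)` with `C = λ·max_a log(1/p̃(a))`. -/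
theorem stmt_13 {S A : Type*} [Fintype S] [Fintype A] [Nonempty S] [Nonempty A]
    (P : S → A → S → ℝ) (hP0 : ∀ s a s', 0 ≤ P s a s')
    (hP1 : ∀ s a, ∑ s', P s a s' = 1)
    (r : S → A → ℝ)
    (γ : ℝ) (hγ0 : 0 ≤ γ) (hγ1 : γ < 1)
    (lam : ℝ) (hlam : 0 < lam)
    (p : A → ℝ) (hp : ∀ a, 0 < p a) (hpsum : ∑ a, p a = 1)
    (pol : S → A → ℝ) (hpol0 : ∀ s a, 0 ≤ pol s a)
    (hpol1 : ∀ s, ∑ a, pol s a = 1)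
    (Qpi : S → A → ℝ) (hQpi : Tpi0 P r γ pol Qpi = Qpi)
    (QpiΩ : S → A → ℝ) (hQpiΩ : Tpi P r γ lam p pol QpiΩ = QpiΩ) :
    let Vpi : S → ℝ := fun s => ∑ a, pol s a * Qpi s a
    let VpiΩ : S → ℝ := fun s => (∑ a, pol s a * QpiΩ s a) - lam * KL (pol s) p
    let C : ℝ := lam * Finset.univ.sup' Finset.univ_nonempty (fun a => Real.log (1 / p a))
    ∀ s, Vpi s - C / (1 - γ) ≤ VpiΩ s ∧ VpiΩ s ≤ Vpi s := by
  intro Vpi VpiΩ C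
  have hD : ∀ s, Vpi s - VpiΩ s = lam * KL (pol s) p +
      γ * ∑ a, pol s a * ∑ s', P s a s' * (Vpi s' - VpiΩ s') := by
    intro s
    have hQ : ∀ a, Qpi s a - QpiΩ s a = γ * ∑ s', P s a s' * (Vpi s' - VpiΩ s') := by
      intro a
      have h1 : r s a + γ * ∑ s', P s a s' * Vpi s' = Qpi s a := congrFun (congrFun hQpi s) a
      have h2 : r s a + γ * ∑ s', P s a s' * VpiΩ s' = QpiΩ s a :=
        congrFun (congrFun hQpiΩ s) a
      simp only [mul_sub, Finset.sum_sub_distrib]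
      linarith
    have h3 : ∑ a, pol s a * (Qpi s a - QpiΩ s a) =
        γ * ∑ a, pol s a * ∑ s', P s a s' * (Vpi s' - VpiΩ s') := by
      rw [Finset.mul_sum]
      exact Finset.sum_congr rfl fun a _ => by rw [hQ a, mul_left_comm]
    rw [← h3]
    simp only [mul_sub, Finset.sum_sub_distrib, Vpi, VpiΩ]
    ring
  have hKL0 : ∀ s, -(lam * KL (pol s) p) ≤ 0 := fun s =>
    neg_nonpos.2 (mul_nonneg hlam.le (KL_nonneg (hpol0 s) hp (by rw [hpsum, hpol1 s])))
  have hKLC : ∀ s, lam * KL (pol s) p ≤ C := fun s =>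
    mul_le_mul_of_nonneg_left (KL_le_of_log_one_div_le (hpol0 s) (hpol1 s) hp fun a =>
      Finset.le_sup' (fun a => Real.log (1 / p a)) (Finset.mem_univ a)) hlam.le
  intro s
  have hupper := policy_eval_le hP0 hP1 hpol0 hpol1 hγ0 hγ1 hKLC hD s
  have hlower := policy_eval_le hP0 hP1 hpol0 hpol1 hγ0 hγ1 hKL0
    (D := fun s => -(Vpi s - VpiΩ s))
    (fun s => by
      simp only [mul_neg, Finset.sum_neg_distrib]
      linarith [hD s]) s
  rw [zero_div] at hlower
  constructor <;> linarith
end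

section
/- In the finite MDP setting, let Q* be the fixed point of the (unregularized) Bellman optimality operator T*, where (T* Q)(s,a) = r(s,a) + γ·∑_{s'} P(s'|s,a)·max_{a'} Q(s',a'), and set V*(s) = max_a Q*(s,a). Let Q*_Ω be the fixed point of the regularized Bellman optimality operator T*_Ω, and let π*_Ω be the softmax policy of Q*_Ω, defined by π*_Ω(a|s) = p̃(a)·exp(Q*_Ω(s,a)/λ) / (∑_{a'} p̃(a')·exp(Q*_Ω(s,a')/λ)). Let Q^{π*_Ω} be the fixed point of the unregularized Bellman operator T^{π*_Ω}, where (T^{π} Q)(s,a) = r(s,a) + γ·∑_{s'} P(s'|s,a)·∑_{a'} π(a'|s')·Q(s',a'), and define V^{π*_Ω}(s) = ∑_a π*_Ω(a|s)·Q^{π*_Ω}(s,a). Set C = λ·max_{a∈A} log(1/p̃(a)). Then for every state s, V^{π*_Ω}(s) ≥ V*(s) − C/(1−γ). -/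
/-- Unregularized Bellman optimality operator `T*`:
`(T* Q)(s,a) = r(s,a) + γ·∑_{s'} P(s'|s,a)·max_{a'} Q(s',a')`. -/
noncomputable def Topt0 {S A : Type*} [Fintype S] [Fintype A] [Nonempty A]
    (P : S → A → S → ℝ) (r : S → A → ℝ) (γ : ℝ)
    (Q : S → A → ℝ) : S → A → ℝ :=
  fun s a => r s a + γ * ∑ s', P s a s' *
    (Finset.univ.sup' Finset.univ_nonempty fun a' => Q s' a')

/-- A function on a finite type all of whose upper bounds contract by `d ↦ γ * d + c` is
bounded by the fixed point `c / (1 - γ)`. -/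
theorem le_div_of_bound_contracts {S : Type*} [Finite S] {γ c : ℝ} (hγ : γ < 1)
    (u : S → ℝ) (h : ∀ d, (∀ s, u s ≤ d) → ∀ s, u s ≤ γ * d + c) (s : S) :
    u s ≤ c / (1 - γ) := by
  have : Nonempty S := ⟨s⟩
  obtain ⟨m, hm⟩ := Finite.exists_max u
  have h1 := h (u m) hm m
  refine (hm s).trans ?_
  rw [le_div_iff₀ (by linarith)]
  linarith

/-- A weighted average of differences is at most any upper bound of the differences. -/
theorem sum_mul_sub_sum_mul_le {S : Type*} [Fintype S] {w : S → ℝ} (hw0 : ∀ s, 0 ≤ w s)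
    (hw1 : ∑ s, w s = 1) {f g : S → ℝ} {d : ℝ} (h : ∀ s, f s - g s ≤ d) :
    ∑ s, w s * f s - ∑ s, w s * g s ≤ d := by
  calc ∑ s, w s * f s - ∑ s, w s * g s = ∑ s, w s * (f s - g s) := by
        rw [← Finset.sum_sub_distrib]
        simp only [mul_sub]
    _ ≤ ∑ s, w s * d := Finset.sum_le_sum fun s _ => mul_le_mul_of_nonneg_left (h s) (hw0 s)
    _ = d := by rw [← Finset.sum_mul, hw1, one_mul]

/-- The log-partition function is at most the mean under the softmax distribution. -/
theorem log_sum_mul_exp_le_sum_softmax {A : Type*} [Fintype A] [Nonempty A] {p : A → ℝ}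
    (hp : ∀ a, 0 < p a) (hpsum : ∑ a, p a = 1) (x : A → ℝ) :
    Real.log (∑ a, p a * Real.exp (x a)) ≤
      ∑ a, p a * Real.exp (x a) / (∑ b, p b * Real.exp (x b)) * x a := by
  set Z := ∑ a, p a * Real.exp (x a) with hZ
  have hZ0 : 0 < Z := Finset.sum_pos (fun a _ => mul_pos (hp a) (Real.exp_pos _))
    Finset.univ_nonempty
  have hsum : ∑ a, p a * Real.exp (x a) / Z = 1 := by
    rw [← Finset.sum_div, ← hZ, div_self hZ0.ne']
  have key : ∀ a, p a * Real.exp (x a) / Z * (Real.log Z - x a) ≤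
      p a - p a * Real.exp (x a) / Z := by
    intro a
    have h1 : Real.log Z - x a ≤ Z / Real.exp (x a) - 1 := by
      have h := Real.add_one_le_exp (Real.log Z - x a)
      rw [Real.exp_sub, Real.exp_log hZ0] at h
      linarith
    have h2 : 0 ≤ p a * Real.exp (x a) / Z :=
      div_nonneg (mul_nonneg (hp a).le (Real.exp_pos _).le) hZ0.le
    refine (mul_le_mul_of_nonneg_left h1 h2).trans_eq ?_
    have := Real.exp_ne_zero (x a)
    field_simp
  have h := Finset.sum_le_sum fun a (_ : a ∈ Finset.univ) => key a
  simp only [mul_sub, Finset.sum_sub_distrib, ← Finset.sum_mul, hsum, hpsum] at h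
  linarith

/-- Each single term bounds the log-partition function from below. -/
theorem add_log_le_log_sum_mul_exp {A : Type*} [Fintype A] {p : A → ℝ}
    (hp : ∀ a, 0 < p a) (x : A → ℝ) (a : A) :
    x a + Real.log (p a) ≤ Real.log (∑ b, p b * Real.exp (x b)) := by
  have h : Real.log (p a * Real.exp (x a)) = x a + Real.log (p a) := by
    rw [Real.log_mul (hp a).ne' (Real.exp_ne_zero _), Real.log_exp, add_comm]
  rw [← h]
  exact Real.log_le_log (mul_pos (hp a) (Real.exp_pos _))
    (Finset.single_le_sum (f := fun b => p b * Real.exp (x b))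
      (fun b _ => (mul_pos (hp b) (Real.exp_pos _)).le) (Finset.mem_univ a))

/-- Sub-optimality of the regularized optimal policy in the original MDP:
`V^{π*_Ω}(s) ≥ V*(s) − C/(1−γ)` with `C = λ·max_a log(1/p̃(a))`. -/
theorem stmt_14 {S A : Type*} [Fintype S] [Fintype A] [Nonempty S] [Nonempty A]
    (P : S → A → S → ℝ) (hP0 : ∀ s a s', 0 ≤ P s a s')
    (hP1 : ∀ s a, ∑ s', P s a s' = 1)
    (r : S → A → ℝ)
    (γ : ℝ) (hγ0 : 0 ≤ γ) (hγ1 : γ < 1)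
    (lam : ℝ) (hlam : 0 < lam)
    (p : A → ℝ) (hp : ∀ a, 0 < p a) (hpsum : ∑ a, p a = 1)
    (Qstar : S → A → ℝ) (hQstar : Topt0 P r γ Qstar = Qstar)
    (QoptΩ : S → A → ℝ) (hQoptΩ : Topt P r γ lam p QoptΩ = QoptΩ)
    (polstar : S → A → ℝ)
    (hpolstar : ∀ s a, polstar s a
      = p a * Real.exp (QoptΩ s a / lam) / (∑ a', p a' * Real.exp (QoptΩ s a' / lam)))
    (Qpistar : S → A → ℝ) (hQpistar : Tpi0 P r γ polstar Qpistar = Qpistar) :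
    let Vstar : S → ℝ := fun s => Finset.univ.sup' Finset.univ_nonempty fun a => Qstar s a
    let Vpistar : S → ℝ := fun s => ∑ a, polstar s a * Qpistar s a
    let C : ℝ := lam * Finset.univ.sup' Finset.univ_nonempty (fun a => Real.log (1 / p a))
    ∀ s, Vstar s - C / (1 - γ) ≤ Vpistar s := by
  intro Vstar Vpistar C s
  set F : S → ℝ := fun s => lam * Real.log (∑ a, p a * Real.exp (QoptΩ s a / lam)) with hF
  have hpol0 : ∀ s a, 0 ≤ polstar s a := fun s a => by
    rw [hpolstar]
    exact div_nonneg (mul_nonneg (hp a).le (Real.exp_pos _).le)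
      (Finset.sum_nonneg fun b _ => (mul_pos (hp b) (Real.exp_pos _)).le)
  have hpol1 : ∀ s, ∑ a, polstar s a = 1 := fun s => by
    simp only [hpolstar]
    rw [← Finset.sum_div]
    exact div_self (Finset.sum_pos (fun a _ => mul_pos (hp a) (Real.exp_pos _))
      Finset.univ_nonempty).ne'
  have hQs : ∀ s a, Qstar s a = r s a + γ * ∑ s', P s a s' * Vstar s' :=
    fun s a => (congrFun₂ hQstar s a).symm
  have hQΩ : ∀ s a, QoptΩ s a = r s a + γ * ∑ s', P s a s' * F s' :=
    fun s a => (congrFun₂ hQoptΩ s a).symm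
  have hQp : ∀ s a, Qpistar s a = r s a + γ * ∑ s', P s a s' * Vpistar s' :=
    fun s a => (congrFun₂ hQpistar s a).symm
  have hFlow : ∀ s a, QoptΩ s a - C ≤ F s := fun s a => by
    have h1 := mul_le_mul_of_nonneg_left
      (add_log_le_log_sum_mul_exp hp (fun a => QoptΩ s a / lam) a) hlam.le
    have h2 := mul_le_mul_of_nonneg_left
      (Finset.le_sup' (fun a => Real.log (1 / p a)) (Finset.mem_univ a)) hlam.le
    rw [mul_add, mul_div_cancel₀ _ hlam.ne'] at h1
    rw [one_div, Real.log_inv] at h2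
    simp only [hF, C]
    linarith
  have hFup : ∀ s, F s ≤ ∑ a, polstar s a * QoptΩ s a := fun s => by
    refine (mul_le_mul_of_nonneg_left
      (log_sum_mul_exp_le_sum_softmax hp hpsum fun a => QoptΩ s a / lam) hlam.le).trans_eq ?_
    rw [Finset.mul_sum]
    refine Finset.sum_congr rfl fun a _ => ?_
    rw [hpolstar, mul_left_comm, mul_div_cancel₀ _ hlam.ne']
  have hstar : Vstar s - F s ≤ C / (1 - γ) := by
    refine le_div_of_bound_contracts hγ1 (fun s => Vstar s - F s) (fun d hd s => ?_) s
    rw [sub_le_iff_le_add]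
    refine Finset.sup'_le _ _ fun a _ => ?_
    have h1 := mul_le_mul_of_nonneg_left
      (sum_mul_sub_sum_mul_le (hP0 s a) (hP1 s a) hd) hγ0
    have h2 := hFlow s a
    rw [hQΩ] at h2
    rw [hQs]
    linarith
  have hpi : F s - Vpistar s ≤ 0 / (1 - γ) := by
    refine le_div_of_bound_contracts hγ1 (fun s => F s - Vpistar s) (fun d hd s => ?_) s
    have h1 : ∑ a, polstar s a * QoptΩ s a - ∑ a, polstar s a * Qpistar s a ≤ γ * d := by
      refine sum_mul_sub_sum_mul_le (hpol0 s) (hpol1 s) fun a => ?_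
      have h := mul_le_mul_of_nonneg_left
        (sum_mul_sub_sum_mul_le (hP0 s a) (hP1 s a) hd) hγ0
      rw [hQΩ, hQp]
      linarith
    have h2 := hFup s
    simp only [Vpistar]
    linarith
  rw [zero_div] at hpi
  linarith
end
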